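/- If Q is a basic sequence which is non-decreasing and infinite in limit, then the set RN^{I}(Q) ∩ RN^{II}(Q) ∩ N^{I}_{Ab}(Q) \ N^{II}(Q) is non-empty. -/

import Mathlib

open Filter MeasureTheory Finset
open scoped Topology Classical

/-- A basic sequence: a sequence of integers, each at least `2`. -/
def IsBasic (q : ℕ → ℕ) : Prop := ∀ n, 2 ≤ q n

/-- The product `q_0 q_1 ⋯ q_{n-1}` of the first `n` terms of the basic sequence. -/
def qprod (q : ℕ → ℕ) (n : ℕ) : ℝ := ∏ i ∈ Finset.range n, (q i : ℝ)

/-- `T_{Q,n}(x) = (q_0 q_1 ⋯ q_{n-1}) x mod 1`. -/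
noncomputable def TQ (q : ℕ → ℕ) (n : ℕ) (x : ℝ) : ℝ := Int.fract (qprod q n * x)

/-- The `n`-th digit `E_n` of the `Q`-Cantor series expansion of `x`
(digit positions are indexed by `0, 1, 2, …`). -/
noncomputable def qdigit (q : ℕ → ℕ) (x : ℝ) (n : ℕ) : ℕ := ⌊(q n : ℝ) * TQ q n x⌋₊

/-- `N_n^Q(B,x)`: the number of occurrences of the block `B` starting among the first `n`
digit positions of the `Q`-Cantor series expansion of `x`. -/
noncomputable def blockCount (q : ℕ → ℕ) (x : ℝ) {k : ℕ} (B : Fin k → ℕ) (n : ℕ) : ℕ :=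
  ((Finset.range n).filter fun i => ∀ j : Fin k, qdigit q x (i + (j : ℕ)) = B j).card

/-- `Q_n^{(k)} = ∑_{j<n} 1/(q_j q_{j+1} ⋯ q_{j+k-1})`. -/
noncomputable def Qsum (q : ℕ → ℕ) (k n : ℕ) : ℝ :=
  ∑ j ∈ Finset.range n, (∏ i ∈ Finset.range k, (q (j + i) : ℝ))⁻¹

/-- `x` is `Q`-normal of order `k`: every block of length `k` occurs with the expected
asymptotic frequency. -/
def QNormalOfOrder (q : ℕ → ℕ) (k : ℕ) (x : ℝ) : Prop :=
  ∀ B : Fin k → ℕ,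
    Tendsto (fun n => (blockCount q x B n : ℝ) / Qsum q k n) atTop (𝓝 1)

/-- `x ∈ N(Q)`: `x` is `Q`-normal of every order `k ≥ 1`. -/
def QNormal (q : ℕ → ℕ) (x : ℝ) : Prop := ∀ k, 1 ≤ k → QNormalOfOrder q k x

/-- `Q` is fully divergent: `Q_n^{(k)} → ∞` for every `k ≥ 1`. -/
def FullyDivergent (q : ℕ → ℕ) : Prop :=
  ∀ k, 1 ≤ k → Tendsto (fun n => Qsum q k n) atTop atTop

/-- `Q` is infinite in limit: `q_n → ∞`. -/
def InfiniteInLimit (q : ℕ → ℕ) : Prop := Tendsto q atTop atTop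

/-- `N_{n,m,r}^Q(B,x)`: occurrences of the block `B` (of length `m`) starting at
positions `i < n` with `i ≡ r (mod m)`. -/
noncomputable def apCount (q : ℕ → ℕ) (x : ℝ) (m r : ℕ) (B : Fin m → ℕ) (n : ℕ) : ℕ :=
  ((Finset.range n).filter fun i =>
    i % m = r ∧ ∀ j : Fin m, qdigit q x (i + (j : ℕ)) = B j).card

/-- `Q_n^{(m,r)} = ∑_{j=0}^{⌊(n-r)/m⌋} 1/(q_{mj+r} q_{mj+r+1} ⋯ q_{mj+r+m-1})`. -/
noncomputable def apQsum (q : ℕ → ℕ) (m r n : ℕ) : ℝ :=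
  ∑ j ∈ Finset.range ((n - r) / m + 1),
    (∏ i ∈ Finset.range m, (q (m * j + r + i) : ℝ))⁻¹

/-- `x ∈ N^{I}_{m,r}(Q)`. -/
def MemNAPI (q : ℕ → ℕ) (m r : ℕ) (x : ℝ) : Prop :=
  ∀ B : Fin m → ℕ,
    Tendsto (fun n => (apCount q x m r B n : ℝ) / apQsum q m r n) atTop (𝓝 1)

/-- `x ∈ N^{I}_{Ab}(Q)`: `x` is AP `Q`-abnormal of type I. -/
def APAbnormalI (q : ℕ → ℕ) (x : ℝ) : Prop :=
  ∀ m, 2 ≤ m → ∀ r, r < m → ¬ MemNAPI q m r x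

/-- `x ∈ RN^{I}(Q)`. -/
def MemRNI (q : ℕ → ℕ) (x : ℝ) : Prop :=
  ∀ m, 1 ≤ m → ∀ r, r < m → ∀ B₁ B₂ : Fin m → ℕ,
    Tendsto (fun n => (apCount q x m r B₁ n : ℝ) / (apCount q x m r B₂ n : ℝ))
      atTop (𝓝 1)

/-- `Λ_{m,r}(Q) = (q_{mt+r})_t`. -/
def lamQ (q : ℕ → ℕ) (m r : ℕ) : ℕ → ℕ := fun t => q (m * t + r)

/-- `Υ_{Q,m,r}(x)`: the real number whose `Λ_{m,r}(Q)`-Cantor series digits are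
`(E_{mt+r})_t`, where `(E_n)` are the `Q`-Cantor series digits of `x`. -/
noncomputable def Ups (q : ℕ → ℕ) (m r : ℕ) (x : ℝ) : ℝ :=
  ∑' t : ℕ, (qdigit q x (m * t + r) : ℝ) / ∏ i ∈ Finset.range (t + 1), (lamQ q m r i : ℝ)

/-- `x ∈ N^{II}_{k,m,r}(Q) = Υ_{Q,m,r}^{-1}(N_k(Λ_{m,r}(Q)))`. -/
def MemNAPII (q : ℕ → ℕ) (k m r : ℕ) (x : ℝ) : Prop :=
  QNormalOfOrder (lamQ q m r) k (Ups q m r x)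

/-- `x ∈ N^{II}(Q)`: `x` is AP `Q`-normal of type II. -/
def APNormalII (q : ℕ → ℕ) (x : ℝ) : Prop :=
  ∀ k, 1 ≤ k → ∀ m, 1 ≤ m → ∀ r, r < m → MemNAPII q k m r x

/-- `x ∈ RN^{II}(Q)`: for all `k, m, r` the counts in `Υ_{Q,m,r}(x)` of any two blocks of
length `k` with respect to `Λ_{m,r}(Q)` have ratio tending to `1`. -/
def MemRNII (q : ℕ → ℕ) (x : ℝ) : Prop :=
  ∀ k, 1 ≤ k → ∀ m, 1 ≤ m → ∀ r, r < m → ∀ B₁ B₂ : Fin k → ℕ,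
    Tendsto (fun n =>
      (blockCount (lamQ q m r) (Ups q m r x) B₁ n : ℝ) /
      (blockCount (lamQ q m r) (Ups q m r x) B₂ n : ℝ)) atTop (𝓝 1)

/-- `S` (a set of positive integers) is almost closed under addition: for every `k ∈ S`,
the set `{x ∉ S : x + k ∈ S}` has asymptotic density `0`. -/
def AlmostClosed (S : Set ℕ) : Prop :=
  ∀ k ∈ S, Tendsto
    (fun t : ℕ => (((Finset.Icc 1 t).filter fun x => x ∉ S ∧ x + k ∈ S).card : ℝ) / t)
    atTop (𝓝 0)

/-- The sequence `u` of reals is uniformly distributed mod 1. -/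
def UDMod1 (u : ℕ → ℝ) : Prop :=
  ∀ a b : ℝ, 0 ≤ a → a < b → b ≤ 1 →
    Tendsto (fun N => (((Finset.range N).filter fun n => u n ∈ Set.Ico a b).card : ℝ) / N)
      atTop (𝓝 (b - a))

/-- `x ∈ DN(Q)`: `x` is `Q`-distribution normal. -/
def DistNormal (q : ℕ → ℕ) (x : ℝ) : Prop := UDMod1 fun n => TQ q n x

/-- `x ∈ DN_{Ab}(Q)`: `x` is AP `Q`-distribution abnormal. -/
def APDistAbnormal (q : ℕ → ℕ) (x : ℝ) : Prop :=
  ∀ m, 2 ≤ m → ∀ r, r < m → ¬ UDMod1 fun n => TQ q (m * n + r) x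

/-- `y ∈ D_{(x_n)}(Q)`: for every `ξ ∈ (0,1)`, the proportion of `n ≤ N` with
`fract (T_{Q,n}(y) - x_n) < ξ` tends to `1`. -/
def MemD (q : ℕ → ℕ) (xs : ℕ → ℝ) (y : ℝ) : Prop :=
  ∀ ξ : ℝ, 0 < ξ → ξ < 1 →
    Tendsto (fun N =>
      (((Finset.range N).filter fun n => Int.fract (TQ q n y - xs n) < ξ).card : ℝ) / N)
      atTop (𝓝 1)

/-- A computable real number. -/
def ComputableReal (x : ℝ) : Prop :=
  ∃ f : ℕ → ℕ, Computable f ∧ ∀ n : ℕ, 0 < n → (f n : ℝ) / n ≤ x ∧ x ≤ ((f n : ℝ) + 1) / n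

/-- The indicator function `1_{ℕ∖S}` of the complement of `S`, with values in `ℤ`. -/
noncomputable def indZ (S : Set ℕ) (i : ℕ) : ℤ := if i ∈ S then 0 else 1

/-- The indicator function `1_{ℕ∖S}` of the complement of `S`, with values in `ℝ`. -/
noncomputable def indR (S : Set ℕ) (i : ℕ) : ℝ := if i ∈ S then 0 else 1

/-- The coefficients `c_{t,i}`: `c_{t,1} = t (1+ε)^{1_{ℕ∖S}(1)}` and
`c_{t,i} = (1+ε)^{1_{ℕ∖S}(i) - 1_{ℕ∖S}(i-1)}` for `i ≥ 2`. -/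
noncomputable def coeff (S : Set ℕ) (ε : ℝ) (t i : ℕ) : ℝ :=
  if i = 1 then (t : ℝ) * (1 + ε) ^ indZ S 1
  else (1 + ε) ^ (indZ S i - indZ S (i - 1))

/-- `N_k(b)`: the set of real numbers normal of order `k` in base `b`. -/
def BaseNormalOfOrder (b k : ℕ) : Set ℝ :=
  {x | ∀ B : Fin k → ℕ, (∀ j, B j < b) →
    Tendsto (fun n => (blockCount (fun _ => b) x B n : ℝ) / n) atTop
      (𝓝 (((b : ℝ) ^ k)⁻¹))}


/-- The value of the Cantor series with basic sequence `q` and digit sequence `e`. -/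
noncomputable def cantorSum (q e : ℕ → ℕ) : ℝ :=
  ∑' t : ℕ, (e t : ℝ) / ∏ i ∈ Finset.range (t + 1), (q i : ℝ)

lemma two_pow_le_prod_of_isBasic {q : ℕ → ℕ} (hq : IsBasic q) (n : ℕ) :
    (2 : ℝ) ^ n ≤ ∏ i ∈ Finset.range n, (q i : ℝ) := by
  have h := Finset.pow_card_le_prod (Finset.range n) (fun i => (q i : ℕ)) 2 (fun i _ => hq i)
  rw [Finset.card_range] at h
  exact_mod_cast h

lemma prod_pos_of_isBasic {q : ℕ → ℕ} (hq : IsBasic q) (n : ℕ) :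
    (0 : ℝ) < ∏ i ∈ Finset.range n, (q i : ℝ) :=
  lt_of_lt_of_le (by positivity) (two_pow_le_prod_of_isBasic hq n)

lemma summable_cantorSum {q e : ℕ → ℕ} (hq : IsBasic q) (he : ∀ n, e n + 2 ≤ q n) :
    Summable fun t : ℕ => (e t : ℝ) / ∏ i ∈ Finset.range (t + 1), (q i : ℝ) := by
  refine Summable.of_nonneg_of_le (fun t => ?_) (fun t => ?_)
    (summable_geometric_of_lt_one (r := (1 / 2 : ℝ)) (by norm_num) (by norm_num))
  · exact div_nonneg (Nat.cast_nonneg _) (prod_pos_of_isBasic hq _).le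
  · have h2 := two_pow_le_prod_of_isBasic hq t
    have hp := prod_pos_of_isBasic hq t
    have hq0 : (0 : ℝ) < q t := by have := hq t; exact_mod_cast (by omega : 0 < q t)
    have heq : (e t : ℝ) ≤ q t := by have := he t; exact_mod_cast (by omega : e t ≤ q t)
    rw [Finset.prod_range_succ, div_le_iff₀ (by positivity), one_div, inv_pow]
    have h3 : (1 : ℝ) ≤ (2 ^ t)⁻¹ * ∏ i ∈ Finset.range t, (q i : ℝ) := by
      rw [inv_mul_eq_div, le_div_iff₀ (by positivity)]
      linarith
    calc (e t : ℝ) ≤ 1 * q t := by linarith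
      _ ≤ ((2 ^ t)⁻¹ * ∏ i ∈ Finset.range t, (q i : ℝ)) * q t := by gcongr
      _ = _ := by ring

lemma mul_cantorSum {q e : ℕ → ℕ} (hq : IsBasic q) (he : ∀ n, e n + 2 ≤ q n) :
    (q 0 : ℝ) * cantorSum q e = e 0 + cantorSum (fun n => q (n + 1)) (fun n => e (n + 1)) := by
  have hq0 : (q 0 : ℝ) ≠ 0 := by have := hq 0; exact_mod_cast (by omega : q 0 ≠ 0)
  unfold cantorSum
  rw [(summable_cantorSum hq he).tsum_eq_zero_add, mul_add, ← tsum_mul_left]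
  congr 1
  · simp [mul_div_cancel₀ _ hq0]
  · refine tsum_congr fun t => ?_
    rw [Finset.prod_range_succ' _ (t + 1), mul_div_assoc', mul_comm (∏ _ ∈ _, _) _,
      mul_div_mul_left _ _ hq0]

lemma cantorSum_nonneg {q : ℕ → ℕ} (hq : IsBasic q) (e : ℕ → ℕ) : 0 ≤ cantorSum q e :=
  tsum_nonneg fun _ => div_nonneg (Nat.cast_nonneg _) (prod_pos_of_isBasic hq _).le

lemma cantorSum_le_one {q e : ℕ → ℕ} (hq : IsBasic q) (he : ∀ n, e n + 2 ≤ q n) :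
    cantorSum q e ≤ 1 := by
  have key : ∀ n, ∑ t ∈ Finset.range n, (e t : ℝ) / ∏ i ∈ Finset.range (t + 1), (q i : ℝ)
      ≤ 1 - 1 / ∏ i ∈ Finset.range n, (q i : ℝ) := by
    intro n
    induction n with
    | zero => simp
    | succ n ih =>
      rw [Finset.sum_range_succ]
      refine (add_le_add_left ih _).trans ?_
      have hp := prod_pos_of_isBasic hq n
      have hq0 : (0 : ℝ) < q n := by have := hq n; exact_mod_cast (by omega : 0 < q n)
      have heq : (e n : ℝ) + 2 ≤ q n := by exact_mod_cast he n
      rw [Finset.prod_range_succ]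
      have : 1 / ∏ i ∈ Finset.range n, (q i : ℝ)
          = q n / ((∏ i ∈ Finset.range n, (q i : ℝ)) * q n) := by
        field_simp
      rw [this]
      have h2 : (e n : ℝ) / ((∏ i ∈ Finset.range n, (q i : ℝ)) * q n)
          + 1 / ((∏ i ∈ Finset.range n, (q i : ℝ)) * q n)
          ≤ q n / ((∏ i ∈ Finset.range n, (q i : ℝ)) * q n) := by
        rw [← add_div]
        gcongr
        linarith
      linarith
  refine (summable_cantorSum hq he).tsum_le_of_sum_range_le fun n => (key n).trans ?_
  have hp := prod_pos_of_isBasic hq n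
  have : 0 < 1 / ∏ i ∈ Finset.range n, (q i : ℝ) := by positivity
  linarith

lemma cantorSum_lt_one {q e : ℕ → ℕ} (hq : IsBasic q) (he : ∀ n, e n + 2 ≤ q n) :
    cantorSum q e < 1 := by
  have h1 := mul_cantorSum hq he
  have h2 := cantorSum_le_one (q := fun n => q (n + 1)) (e := fun n => e (n + 1))
    (fun n => hq _) (fun n => he _)
  have heq : (e 0 : ℝ) + 2 ≤ q 0 := by exact_mod_cast he 0
  have hq0 : (0 : ℝ) < q 0 := by have := hq 0; exact_mod_cast (by omega : 0 < q 0)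
  by_contra! h
  nlinarith

lemma exists_qprod_mul_cantorSum {q e : ℕ → ℕ} (hq : IsBasic q) (he : ∀ n, e n + 2 ≤ q n)
    (n : ℕ) : ∃ z : ℤ, qprod q n * cantorSum q e
      = z + cantorSum (fun i => q (n + i)) (fun i => e (n + i)) := by
  induction n with
  | zero => exact ⟨0, by simp [qprod]⟩
  | succ n ih =>
    obtain ⟨z, hz⟩ := ih
    refine ⟨q n * z + e n, ?_⟩
    have h := mul_cantorSum (q := fun i => q (n + i)) (e := fun i => e (n + i))
      (fun i => hq _) (fun i => he _)
    have hs : qprod q (n + 1) = qprod q n * q n := Finset.prod_range_succ _ _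
    rw [hs, mul_right_comm, hz]
    simp only [add_zero, ← add_assoc, add_right_comm n _ 1] at h
    push_cast
    rw [add_mul, mul_comm _ (q n : ℝ), mul_comm _ (q n : ℝ), h]
    simp only [add_right_comm n 1 _]
    ring

lemma qdigit_cantorSum {q e : ℕ → ℕ} (hq : IsBasic q) (he : ∀ n, e n + 2 ≤ q n) (n : ℕ) :
    qdigit q (cantorSum q e) n = e n := by
  obtain ⟨z, hz⟩ := exists_qprod_mul_cantorSum hq he n
  have hq' : IsBasic fun i => q (n + i) := fun i => hq _
  have he' : ∀ i, e (n + i) + 2 ≤ q (n + i) := fun i => he _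
  have hT : TQ q n (cantorSum q e) = cantorSum (fun i => q (n + i)) (fun i => e (n + i)) := by
    unfold TQ
    rw [hz, Int.fract_intCast_add, Int.fract_eq_self]
    exact ⟨cantorSum_nonneg hq' _, cantorSum_lt_one hq' he'⟩
  unfold qdigit
  rw [hT]
  have h := mul_cantorSum hq' he'
  simp only [add_zero] at h
  rw [h, add_comm, Nat.floor_add_natCast (cantorSum_nonneg (fun i => hq _) _),
    Nat.floor_eq_zero.2 (cantorSum_lt_one (fun i => hq _) fun i => he _), zero_add]

lemma Ups_cantorSum {q e : ℕ → ℕ} (hq : IsBasic q) (he : ∀ n, e n + 2 ≤ q n) (m r : ℕ) :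
    Ups q m r (cantorSum q e) = cantorSum (lamQ q m r) fun t => e (m * t + r) := by
  unfold Ups
  simp only [qdigit_cantorSum hq he]
  rfl

/-- The indicator that the digits of `e` at positions `i, i + d, i + 2 * d, …` spell `B`. -/
noncomputable def patternIndicator (e : ℕ → ℕ) (d : ℕ) {k : ℕ} (B : Fin k → ℕ) (i : ℕ) : ℝ :=
  if ∀ j : Fin k, e (i + d * j) = B j then 1 else 0

/-- The number of `t < n` such that the digits of `e` at the positions `m * t + r + d * j`
spell `B`. -/
noncomputable def patternCount (e : ℕ → ℕ) (m r d : ℕ) {k : ℕ} (B : Fin k → ℕ) (n : ℕ) : ℝ :=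
  ∑ t ∈ Finset.range n, patternIndicator e d B (m * t + r)

lemma patternIndicator_nonneg (e : ℕ → ℕ) (d : ℕ) {k : ℕ} (B : Fin k → ℕ) (i : ℕ) :
    0 ≤ patternIndicator e d B i := by
  unfold patternIndicator; split_ifs <;> norm_num

lemma patternIndicator_le_one (e : ℕ → ℕ) (d : ℕ) {k : ℕ} (B : Fin k → ℕ) (i : ℕ) :
    patternIndicator e d B i ≤ 1 := by
  unfold patternIndicator; split_ifs <;> norm_num

lemma sum_range_mul_eq {M : Type*} [AddCommMonoid M] (g : ℕ → M) (a N : ℕ) :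
    ∑ t ∈ Finset.range (a * N), g t
      = ∑ w ∈ Finset.range N, ∑ u ∈ Finset.range a, g (a * w + u) := by
  induction N with
  | zero => simp
  | succ N ih => rw [mul_add, mul_one, Finset.sum_range_add, ih, Finset.sum_range_succ]

/-- Partial sums of a periodic function whose sum over a period is small. -/
lemma abs_sum_range_le_of_periodic {h : ℕ → ℝ} {P : ℕ} {C : ℝ} (hP : 0 < P)
    (hper : Function.Periodic h P) (h1 : ∀ t, |h t| ≤ 1)
    (hC : |∑ t ∈ Finset.range P, h t| ≤ C) (n : ℕ) :
    |∑ t ∈ Finset.range n, h t| ≤ P + n * (C / P) := by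
  have hmul : ∀ w t, h (P * w + t) = h t := fun w t => by
    rw [add_comm, mul_comm]; exact hper.nat_mul w t
  have hC0 : 0 ≤ C := (abs_nonneg _).trans hC
  have hP' : (0 : ℝ) < P := by exact_mod_cast hP
  conv_lhs => rw [← Nat.div_add_mod n P]
  rw [Finset.sum_range_add, sum_range_mul_eq]
  simp only [hmul]
  rw [add_comm]
  refine (abs_add_le _ _).trans (add_le_add ?_ ?_)
  · refine (Finset.abs_sum_le_sum_abs _ _).trans ?_
    refine (Finset.sum_le_card_nsmul _ _ 1 fun t _ => h1 t).trans ?_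
    rw [Finset.card_range, nsmul_eq_mul, mul_one]
    exact_mod_cast (Nat.mod_lt n hP).le
  · rw [Finset.sum_const, Finset.card_range, nsmul_eq_mul, abs_mul, Nat.abs_cast,
      mul_div_left_comm, mul_comm C]
    refine mul_le_mul ?_ hC (abs_nonneg _) (by positivity)
    exact Nat.cast_div_le

/-- The number of `w < b ^ L` with prescribed base-`b` digits at `k` given places. -/
lemma sum_digits_eq {b L k : ℕ} (hb : 0 < b) (p : Fin k → ℕ) (hp : ∀ j, p j < L)
    (hinj : Function.Injective p) (B : Fin k → ℕ) (hB : ∀ j, B j < b) :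
    ∑ w ∈ Finset.range (b ^ L), (if ∀ j, w / b ^ p j % b = B j then (1 : ℝ) else 0)
      = (b : ℝ) ^ L / (b : ℝ) ^ k := by
  have hb' : (b : ℝ) ≠ 0 := by positivity
  rw [Finset.sum_range]
  rw [← Equiv.sum_comp (finFunctionFinEquiv (m := b) (n := L))]
  have hdig : ∀ (g : Fin L → Fin b) (j : Fin k),
      ((finFunctionFinEquiv g : Fin (b ^ L)) : ℕ) / b ^ p j % b = g ⟨p j, hp j⟩ := by
    intro g j
    have := congrFun (finFunctionFinEquiv.symm_apply_apply g) ⟨p j, hp j⟩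
    exact congrArg Fin.val this
  simp only [hdig]
  rw [Finset.sum_boole]
  set P : Fin k → Fin L := fun j => ⟨p j, hp j⟩ with hPdef
  have hPinj : Function.Injective P := fun i j h => hinj (by simpa [hPdef] using h)
  let S : Fin L → Finset (Fin b) := fun i =>
    if i ∈ Set.range P then Finset.univ.filter fun c => ∀ j, P j = i → (c : ℕ) = B j
    else Finset.univ
  have hS : (Finset.univ.filter fun g : Fin L → Fin b => ∀ j, ((g (P j) : Fin b) : ℕ) = B j)
      = Fintype.piFinset S := by
    ext g
    simp only [Finset.mem_filter, Finset.mem_univ, true_and, Fintype.mem_piFinset, S]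
    constructor
    · intro h i
      split_ifs with hi
      · simp only [Finset.mem_filter, Finset.mem_univ, true_and]
        rintro j rfl
        exact h j
      · simp
    · intro h j
      have := h (P j)
      rw [if_pos ⟨j, rfl⟩] at this
      simp only [Finset.mem_filter, Finset.mem_univ, true_and] at this
      exact this j rfl
  have hcard : ∀ i, (S i).card = if i ∈ Finset.univ.image P then 1 else b := by
    intro i
    by_cases hi : i ∈ Set.range P
    · obtain ⟨j, rfl⟩ := hi
      simp only [S, Set.mem_range_self, if_true, Finset.mem_image, Finset.mem_univ, true_and,
        exists_apply_eq_apply]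
      rw [Finset.card_eq_one]
      refine ⟨⟨B j, hB j⟩, ?_⟩
      ext c
      simp only [Finset.mem_filter, Finset.mem_univ, true_and, Finset.mem_singleton, Fin.ext_iff]
      constructor
      · intro h; exact h j rfl
      · intro h j' hj'
        rw [hPinj (by simpa [Fin.ext_iff] using hj' : P j' = P j)]
        exact h
    · have hi' : i ∉ Finset.univ.image P := by simpa using hi
      simp only [S, if_neg hi, if_neg hi', Finset.card_univ, Fintype.card_fin]
  have hcong : ((Finset.univ.filter fun g : Fin L → Fin b =>
      ∀ j, ((g (P j) : Fin b) : ℕ) = B j).card : ℝ) = (b : ℝ) ^ L / (b : ℝ) ^ k := by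
    rw [hS, Fintype.card_piFinset]
    simp only [hcard]
    have h1 : (∏ i : Fin L, if i ∈ Finset.univ.image P then 1 else b) * b ^ k = b ^ L := by
      have h2 : b ^ k = ∏ i : Fin L, if i ∈ Finset.univ.image P then b else 1 := by
        rw [Finset.prod_ite_mem, Finset.univ_inter, Finset.prod_const,
          Finset.card_image_of_injective _ hPinj, Finset.card_univ, Fintype.card_fin]
      rw [h2, ← Finset.prod_mul_distrib]
      have h3 : ∀ i : Fin L, ((if i ∈ Finset.univ.image P then 1 else b) *
          if i ∈ Finset.univ.image P then b else 1) = b := fun i => by split_ifs <;> simp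
      rw [Finset.prod_congr rfl fun i _ => h3 i]
      simp
    rw [eq_div_iff (by positivity)]
    exact_mod_cast h1
  convert hcong

/-- The digit sequence obtained by concatenating, over and over again, all words of length `L`
in the alphabet `{0, …, b - 1}`. -/
def wordSeq (b L n : ℕ) : ℕ := n / L / b ^ (n % L) % b

lemma wordSeq_mul_add {L u : ℕ} (b w : ℕ) (hu : u < L) :
    wordSeq b L (L * w + u) = w / b ^ u % b := by
  unfold wordSeq
  rw [Nat.mul_add_div (by omega), Nat.mul_add_mod, Nat.div_eq_of_lt hu, Nat.mod_eq_of_lt hu,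
    add_zero]

lemma wordSeq_periodic {b L : ℕ} (hb : 0 < b) (hL : 0 < L) :
    Function.Periodic (wordSeq b L) (L * b ^ L) := by
  intro n
  unfold wordSeq
  have hlt : n % L < L := Nat.mod_lt n hL
  obtain ⟨c, hc⟩ := Nat.exists_eq_add_of_lt hlt
  have hpow : b ^ L = b ^ (n % L) * (b * b ^ c) := by
    rw [← pow_succ', ← pow_add]; congr 1
  rw [Nat.add_mul_mod_self_left, Nat.add_mul_div_left _ _ hL]
  generalize n % L = u at *
  rw [hpow, Nat.add_mul_div_left _ _ (by positivity), Nat.add_mul_mod_self_left]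

lemma abs_patternIndicator_sub_le (e : ℕ → ℕ) (d : ℕ) {k : ℕ} (B : Fin k → ℕ) (i : ℕ) {c : ℝ}
    (h0 : 0 ≤ c) (h1 : c ≤ 1) : |patternIndicator e d B i - c| ≤ 1 := by
  have h2 := patternIndicator_nonneg e d B i
  have h3 := patternIndicator_le_one e d B i
  rw [abs_le]; constructor <;> linarith

lemma card_filter_range_le_add (n a : ℕ) :
    ((Finset.range n).filter fun t => n ≤ t + a).card ≤ a := by
  calc _ ≤ (Finset.Ico (n - a) n).card := Finset.card_le_card fun t ht => by
        simp only [Finset.mem_filter, Finset.mem_range, Finset.mem_Ico] at ht ⊢; omega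
    _ ≤ a := by rw [Nat.card_Ico]; omega

lemma abs_patternCount_wordSeq_le {b m l r d k : ℕ} (hb : 0 < b) (hl : 0 < l) (hr : r < m)
    (hd : 0 < d) (B : Fin k → ℕ) (hB : ∀ j, B j < b) (n : ℕ) :
    |patternCount (wordSeq b (m * l)) m r d B n - n / (b : ℝ) ^ k|
      ≤ (l * b ^ (m * l) : ℕ) + n * ((d * k : ℕ) / (l : ℝ)) := by
  have hm : 0 < m := by omega
  have hb1 : (1 : ℝ) ≤ b := by exact_mod_cast hb
  have hl' : (0 : ℝ) < l := by exact_mod_cast hl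
  set c : ℝ := 1 / (b : ℝ) ^ k with hc
  have hc0 : 0 ≤ c := by positivity
  have hc1 : c ≤ 1 := by rw [hc, div_le_one (by positivity)]; exact one_le_pow₀ hb1
  set e := wordSeq b (m * l) with he
  set h : ℕ → ℝ := fun t => patternIndicator e d B (m * t + r) - c with hh
  have hsum : patternCount e m r d B n - n / (b : ℝ) ^ k = ∑ t ∈ Finset.range n, h t := by
    rw [hh, Finset.sum_sub_distrib, Finset.sum_const, Finset.card_range, nsmul_eq_mul, hc,
      mul_one_div]
    rfl
  have h1 : ∀ t, |h t| ≤ 1 := fun t => abs_patternIndicator_sub_le e d B _ hc0 hc1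
  have hper : Function.Periodic h (l * b ^ (m * l)) := by
    intro t
    have hp := wordSeq_periodic hb (L := m * l) (by positivity)
    have : ∀ j : Fin k, e (m * (t + l * b ^ (m * l)) + r + d * j) = e (m * t + r + d * j) := by
      intro j
      rw [he, ← hp (m * t + r + d * j)]
      congr 1; ring
    simp only [hh, patternIndicator, this]
  have hper1 : |∑ t ∈ Finset.range (l * b ^ (m * l)), h t|
      ≤ ((d * k : ℕ) : ℝ) * (b : ℝ) ^ (m * l) := by
    rw [sum_range_mul_eq, Finset.sum_comm]
    have hu : ∀ u ∈ Finset.range l, |∑ w ∈ Finset.range (b ^ (m * l)), h (l * w + u)|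
        ≤ if l ≤ u + d * k then (b : ℝ) ^ (m * l) else 0 := by
      intro u hul
      rw [Finset.mem_range] at hul
      split_ifs with hbad
      · refine (Finset.abs_sum_le_sum_abs _ _).trans ?_
        refine (Finset.sum_le_card_nsmul _ _ 1 fun t _ => h1 _).trans ?_
        simp
      · have hpos : ∀ j : Fin k, m * u + r + d * j < m * l := by
          intro j
          have hj : d * j + d ≤ d * k := by
            rw [← Nat.mul_succ]; exact Nat.mul_le_mul_left d j.2
          have h5 : u + (d * j + 1) ≤ l := by omega
          have h6 := Nat.mul_le_mul_left m h5
          have h7 : d * j ≤ m * (d * j) := Nat.le_mul_of_pos_left _ hm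
          rw [mul_add, mul_add, mul_one] at h6
          omega
        have hind : ∀ w, patternIndicator e d B (m * (l * w + u) + r)
            = if ∀ j : Fin k, w / b ^ (m * u + r + d * j) % b = B j then 1 else 0 := by
          intro w
          have : ∀ j : Fin k, e (m * (l * w + u) + r + d * j)
              = w / b ^ (m * u + r + d * j) % b := by
            intro j
            rw [← wordSeq_mul_add b w (hpos j), he]
            congr 1; ring
          simp only [patternIndicator, this]
        have hinj : Function.Injective fun j : Fin k => m * u + r + d * (j : ℕ) := by
          intro i j hij
          have : d * (i : ℕ) = d * j := by simpa using hij
          exact Fin.ext (Nat.eq_of_mul_eq_mul_left hd this)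
        simp only [hh]
        rw [Finset.sum_sub_distrib, Finset.sum_congr rfl fun w _ => hind w,
          sum_digits_eq hb _ hpos hinj B hB, Finset.sum_const, Finset.card_range, nsmul_eq_mul]
        simp [hc, div_eq_mul_inv]
    refine (Finset.abs_sum_le_sum_abs _ _).trans ((Finset.sum_le_sum hu).trans ?_)
    rw [← Finset.sum_filter, Finset.sum_const, nsmul_eq_mul]
    gcongr
    exact card_filter_range_le_add l (d * k)
  have := abs_sum_range_le_of_periodic (by positivity) hper h1 hper1 n
  rw [hsum]
  refine this.trans (le_of_eq ?_)
  push_cast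
  have : (b : ℝ) ^ (m * l) ≠ 0 := by positivity
  field_simp

/-- A single sequence in the alphabet `{0, …, s}` in which all short patterns along all short
arithmetic progressions occur with almost the right frequency. -/
lemma exists_uniform_sequence (s : ℕ) {ε : ℝ} (hε : 0 < ε) :
    ∃ f : ℕ → ℕ, ∃ D : ℕ, (∀ n, f n ≤ s) ∧
      ∀ m r d k : ℕ, m ≤ s → r < m → 0 < d → d ≤ s → k ≤ s → ∀ B : Fin k → ℕ, (∀ j, B j ≤ s) →
        ∀ n : ℕ, |patternCount f m r d B n - n / ((s : ℝ) + 1) ^ k| ≤ D + n * ε := by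
  obtain ⟨R, hR⟩ := exists_nat_gt ((s * s : ℕ) / ε)
  have hR0 : 0 < R := by
    have : (0 : ℝ) < R := lt_of_le_of_lt (by positivity) hR
    exact_mod_cast this
  set L := s.factorial * R with hL
  refine ⟨wordSeq (s + 1) L, L * (s + 1) ^ L, fun n => ?_, ?_⟩
  · exact Nat.le_of_lt_succ (Nat.mod_lt _ (Nat.succ_pos s))
  intro m r d k hm hr hd hds hk B hB n
  obtain ⟨c, hcs⟩ := Nat.dvd_factorial (by omega : 0 < m) hm
  have hc : 0 < c := by
    rcases Nat.eq_zero_or_pos c with rfl | h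
    · simp [Nat.factorial_ne_zero] at hcs
    · exact h
  have hLm : L = m * (c * R) := by rw [hL, hcs, mul_assoc]
  have key := abs_patternCount_wordSeq_le (b := s + 1) (l := c * R) (Nat.succ_pos s)
    (by positivity) hr hd B (fun j => Nat.lt_succ_of_le (hB j)) n
  rw [← hLm] at key
  push_cast at key
  refine key.trans ?_
  have h1 : (c * R : ℕ) ≤ L := by rw [hLm]; exact Nat.le_mul_of_pos_left _ (by omega)
  have h2 : ((c : ℝ) * R) ≤ L := by exact_mod_cast h1
  have h3 : (d * k : ℝ) / (c * R) ≤ ε := by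
    have hc1 : (1 : ℝ) ≤ c := by exact_mod_cast hc
    have hRp : (0 : ℝ) < R := by exact_mod_cast hR0
    rw [div_lt_iff₀ hε] at hR
    rw [div_le_iff₀ (by positivity)]
    have h4 : (d * k : ℝ) ≤ (s * s : ℕ) := by exact_mod_cast Nat.mul_le_mul hds hk
    have h5 : (R : ℝ) ≤ c * R := by nlinarith
    nlinarith
  push_cast
  gcongr

lemma exists_stage {N : ℕ → ℕ} (hN : StrictMono N) (h0 : N 0 = 0) :
    ∃ σ : ℕ → ℕ, Monotone σ ∧ Tendsto σ atTop atTop ∧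
      (∀ n, N (σ n) ≤ n ∧ n < N (σ n + 1)) ∧
      ∀ n s, N s ≤ n → n < N (s + 1) → σ n = s := by
  have hex : ∀ n, ∃ s, N s ≤ n ∧ n < N (s + 1) := by
    intro n
    refine ⟨Nat.findGreatest (fun s => N s ≤ n) n, ?_, ?_⟩
    · exact Nat.findGreatest_spec (P := fun s => N s ≤ n) (Nat.zero_le n) (by simp [h0])
    · by_contra! h
      have h1 : Nat.findGreatest (fun s => N s ≤ n) n + 1 ≤ n := (hN.le_apply).trans h
      have := Nat.le_findGreatest (P := fun s => N s ≤ n) h1 h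
      omega
  choose σ hσ1 hσ2 using hex
  have hle : ∀ n s, N s ≤ n → s ≤ σ n := fun n s h =>
    Nat.lt_succ_iff.1 (hN.lt_iff_lt.1 (h.trans_lt (hσ2 n)))
  refine ⟨σ, fun a b hab => hle b _ ((hσ1 a).trans hab), ?_,
    fun n => ⟨hσ1 n, hσ2 n⟩, fun n s h1 h2 => ?_⟩
  · refine tendsto_atTop.2 fun s => ?_
    filter_upwards [eventually_ge_atTop (N s)] with n hn using hle n s hn
  · exact le_antisymm (Nat.lt_succ_iff.1 (hN.lt_iff_lt.1 ((hσ1 n).trans_lt h2))) (hle n s h1)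

lemma mul_add_lt_iff_lt_div {m r : ℕ} (hr : r < m) (t n : ℕ) :
    m * t + r < n ↔ t < (n + (m - 1 - r)) / m := by
  rw [Nat.lt_iff_add_one_le, Nat.lt_iff_add_one_le, Nat.le_div_iff_mul_le (by omega),
    mul_comm (t + 1), mul_add]
  omega

/-- On a range of positions where `e` agrees with a uniform sequence `f`, pattern counts of `e`
are close to their expected value. -/
lemma abs_sum_Ico_le {e f : ℕ → ℕ} {W : ℕ → ℝ} {N N' m r d k : ℕ} {B : Fin k → ℕ}
    {c D ε : ℝ} (hr : r < m) (hε : 0 ≤ ε)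
    (hef : ∀ i, N ≤ i → i < N' → e i = f i) (hW : ∀ i, N ≤ i → i < N' → W i = c)
    (hf : ∀ n : ℕ, |patternCount f m r d B n - n * c| ≤ D + n * ε)
    {T u : ℕ} (hTu : T ≤ u) (hT : ∀ t, T ≤ t → N ≤ m * t + r) (hu : ∀ t < u, m * t + r < N') :
    |∑ t ∈ Finset.Ico T u, (patternIndicator e d B (m * t + r) - W (m * t + r))|
      ≤ 2 * (D + u * ε) + d * k := by
  have hsplit : ∑ t ∈ Finset.Ico T u, (patternIndicator e d B (m * t + r) - W (m * t + r))
      = ∑ t ∈ Finset.Ico T u,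
          (patternIndicator e d B (m * t + r) - patternIndicator f d B (m * t + r))
        + ∑ t ∈ Finset.Ico T u, (patternIndicator f d B (m * t + r) - c) := by
    rw [← Finset.sum_add_distrib]
    refine Finset.sum_congr rfl fun t ht => ?_
    rw [Finset.mem_Ico] at ht
    rw [hW _ (hT t ht.1) (hu t ht.2)]
    ring
  have hS : ∀ n : ℕ, ∑ t ∈ Finset.range n, (patternIndicator f d B (m * t + r) - c)
      = patternCount f m r d B n - n * c := fun n => by
    rw [Finset.sum_sub_distrib, Finset.sum_const, Finset.card_range, nsmul_eq_mul]; rfl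
  have h2 : |∑ t ∈ Finset.Ico T u, (patternIndicator f d B (m * t + r) - c)|
      ≤ 2 * (D + u * ε) := by
    rw [Finset.sum_Ico_eq_sub _ hTu, hS, hS]
    have hTu' : (T : ℝ) ≤ u := by exact_mod_cast hTu
    have := abs_sub (patternCount f m r d B u - u * c) (patternCount f m r d B T - T * c)
    have h3 := hf u
    have h4 := hf T
    nlinarith
  have h1 : |∑ t ∈ Finset.Ico T u,
      (patternIndicator e d B (m * t + r) - patternIndicator f d B (m * t + r))| ≤ d * k := by
    refine (Finset.abs_sum_le_sum_abs _ _).trans ?_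
    have hb : ∀ t ∈ Finset.Ico T u,
        |patternIndicator e d B (m * t + r) - patternIndicator f d B (m * t + r)|
          ≤ if u ≤ t + d * k then (1 : ℝ) else 0 := by
      intro t ht
      rw [Finset.mem_Ico] at ht
      split_ifs with hbad
      · exact abs_patternIndicator_sub_le e d B _ (patternIndicator_nonneg _ _ _ _)
          (patternIndicator_le_one _ _ _ _)
      · have heq : ∀ j : Fin k, e (m * t + r + d * j) = f (m * t + r + d * j) := by
          intro j
          refine hef _ ((hT t ht.1).trans (Nat.le_add_right _ _)) ?_
          have hj : d * j ≤ d * k := Nat.mul_le_mul_left d j.2.le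
          have h5 := hu (t + d * j) (by omega)
          have h7 : d * j ≤ m * (d * j) := Nat.le_mul_of_pos_left _ (by omega)
          rw [mul_add] at h5
          omega
        simp [patternIndicator, heq]
    refine (Finset.sum_le_sum hb).trans ?_
    rw [Finset.sum_boole]
    have hcard : ((Finset.Ico T u).filter fun t => u ≤ t + d * k).card ≤ d * k :=
      (Finset.card_le_card (Finset.filter_subset_filter _ fun t ht => by
        simp only [Finset.mem_Ico, Finset.mem_range] at ht ⊢; exact ht.2)).trans
        (card_filter_range_le_add u (d * k))
    exact_mod_cast hcard
  rw [hsplit]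
  have := abs_add_le (∑ t ∈ Finset.Ico T u,
    (patternIndicator e d B (m * t + r) - patternIndicator f d B (m * t + r)))
    (∑ t ∈ Finset.Ico T u, (patternIndicator f d B (m * t + r) - c))
  linarith

lemma exists_rapid_sequence (G : ℕ → ℕ → ℕ) :
    ∃ N : ℕ → ℕ, N 0 = 0 ∧ StrictMono N ∧ ∀ s, G s (N s) ≤ N (s + 1) := by
  let N : ℕ → ℕ := fun n => Nat.rec 0 (fun s y => G s y + y + 1) n
  have hs : ∀ s, N (s + 1) = G s (N s) + N s + 1 := fun s => rfl
  exact ⟨N, rfl, strictMono_nat_of_lt_succ fun s => by rw [hs]; omega,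
    fun s => by rw [hs]; omega⟩

lemma eventually_sum_inv_le {q : ℕ → ℕ} (hinf : InfiniteInLimit q) {δ : ℝ} (hδ : 0 < δ) :
    ∃ n₀ : ℕ, ∀ n ≥ n₀, ∑ j ∈ Finset.range (n + 1), ((q j : ℝ))⁻¹ ≤ δ * n := by
  have h1 : Tendsto (fun n => ((q n : ℝ))⁻¹) atTop (𝓝 0) :=
    tendsto_inv_atTop_zero.comp (tendsto_natCast_atTop_atTop.comp hinf)
  have h2 := (h1.cesaro.comp (tendsto_add_atTop_nat 1)).eventually
    (gt_mem_nhds (half_pos hδ))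
  obtain ⟨n₀, hn₀⟩ := eventually_atTop.1 h2
  refine ⟨max n₀ 1, fun n hn => ?_⟩
  have h3 := hn₀ n ((le_max_left _ _).trans hn)
  have h4 : (1 : ℝ) ≤ n := by exact_mod_cast (le_max_right _ _).trans hn
  simp only [Function.comp_apply] at h3
  rw [inv_mul_lt_iff₀ (by positivity)] at h3
  push_cast at h3
  nlinarith

/-- The main construction: a digit sequence in which all blocks of a given length occur with
asymptotically equal frequency along every arithmetic progression, and far more often than
expected. -/
theorem exists_uniform_digits {q : ℕ → ℕ} (hq : IsBasic q) (hinf : InfiniteInLimit q) :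
    ∃ e : ℕ → ℕ, (∀ n, e n + 2 ≤ q n) ∧
      ∀ m r d k : ℕ, r < m → 0 < d → ∃ M : ℕ → ℝ, (∀ᶠ n in atTop, 0 < M n) ∧
        Tendsto (fun n => (∑ j ∈ Finset.range (n + 1), ((q j : ℝ))⁻¹) / M n) atTop (𝓝 0) ∧
        ∀ B : Fin k → ℕ, Tendsto (fun n => patternCount e m r d B n / M n) atTop (𝓝 1) := by
  have hε : ∀ s : ℕ, (0 : ℝ) < 1 / ((s : ℝ) + 2) ^ (s + 2) := fun s => by positivity
  choose f D hfs hfD using fun s => exists_uniform_sequence s (hε s)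
  choose A hA using fun s => eventually_sum_inv_le hinf (hε s)
  choose A' hA' using fun s : ℕ => eventually_atTop.1 (tendsto_atTop.1 hinf (s + 3))
  obtain ⟨N, hN0, hN, hNG⟩ := exists_rapid_sequence fun p y =>
    (p + 2) ^ (p + 3) * (y + 2 * D (p + 1) + 2 * D p + 2 * (p * p)) + (p + 2) * A p + A' p
  obtain ⟨σ, hσm, hσt, hσ', hσ⟩ := exists_stage hN hN0
  refine ⟨fun n => f (σ n) n, fun n => ?_, fun m r d k hr hd => ?_⟩
  · have h1 := hfs (σ n) n
    change f (σ n) n + 2 ≤ q n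
    rcases hs : σ n with _ | p
    · rw [hs] at h1
      have := hq n
      omega
    · rw [hs] at h1
      have h2 := (hσ' n).1
      rw [hs] at h2
      have h3 := hA' p n ((le_trans (by omega) (hNG p)).trans h2)
      omega
  set W : ℕ → ℝ := fun i => 1 / ((σ i : ℝ) + 1) ^ k with hW
  set M : ℕ → ℝ := fun n => ∑ t ∈ Finset.range n, W (m * t + r) with hM
  have hm : 0 < m := by omega
  have hW0 : ∀ i, 0 < W i := fun i => by simp only [hW]; positivity
  have hW1 : ∀ i, W i ≤ 1 := fun i => by
    simp only [hW]
    rw [div_le_one (by positivity)]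
    exact one_le_pow₀ (by linarith [Nat.cast_nonneg (α := ℝ) (σ i)])
  have hlow : ∀ n p : ℕ, σ (m * n) = p + 1 → k ≤ p →
      (n : ℝ) / ((p : ℝ) + 2) ^ p ≤ M n := by
    intro n p hp hk
    have h1 : ∀ t ∈ Finset.range n, 1 / ((p : ℝ) + 2) ^ p ≤ W (m * t + r) := by
      intro t ht
      rw [Finset.mem_range] at ht
      have h2 : m * t + r ≤ m * n := by
        have := Nat.mul_le_mul_left m (Nat.succ_le_of_lt ht)
        rw [Nat.succ_eq_add_one, mul_add] at this
        omega
      have h3 : (σ (m * t + r) : ℝ) ≤ p + 1 := by exact_mod_cast hp ▸ hσm h2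
      simp only [hW]
      refine one_div_le_one_div_of_le (by positivity) ?_
      calc ((σ (m * t + r) : ℝ) + 1) ^ k ≤ ((p : ℝ) + 2) ^ k :=
            pow_le_pow_left₀ (by positivity) (by linarith) k
        _ ≤ ((p : ℝ) + 2) ^ p := pow_le_pow_right₀ (by linarith [Nat.cast_nonneg (α := ℝ) p]) hk
    have := Finset.card_nsmul_le_sum _ _ _ h1
    rw [Finset.card_range, nsmul_eq_mul, mul_one_div] at this
    exact this
  have hstage : ∀ C : ℕ, ∀ᶠ n in atTop, ∃ p, σ (m * n) = p + 1 ∧ C ≤ p := by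
    intro C
    have h1 : Tendsto (fun n => σ (m * n)) atTop atTop :=
      hσt.comp (tendsto_id.const_mul_atTop' hm)
    filter_upwards [h1.eventually_ge_atTop (C + 1)] with n hn
    exact ⟨σ (m * n) - 1, by omega, by omega⟩
  have hbound : ∀ n p : ℕ, σ (m * n) = p + 1 → m ≤ p →
      ((p : ℝ) + 2) ^ (p + 2) * ((N p : ℝ) + 2 * D (p + 1) + 2 * D p + 2 * (p * p)) ≤ n
        ∧ A p ≤ n := by
    intro n p hp hmp
    have h1 := (hσ' (m * n)).1
    rw [hp] at h1
    have h2 := (hNG p).trans (h1.trans (Nat.mul_le_mul_right n (by omega : m ≤ p + 2)))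
    constructor
    · have h3 : (p + 2) * ((p + 2) ^ (p + 2) *
          (N p + 2 * D (p + 1) + 2 * D p + 2 * (p * p))) ≤ (p + 2) * n := by
        rw [← mul_assoc, ← pow_succ']
        exact (Nat.le_add_right _ _).trans ((Nat.le_add_right _ _).trans h2)
      exact_mod_cast Nat.le_of_mul_le_mul_left h3 (by omega)
    · have h3 : (p + 2) * A p ≤ (p + 2) * n := by
        refine le_trans ?_ h2
        omega
      exact Nat.le_of_mul_le_mul_left h3 (by omega)
  have hMY : ∀ n p : ℕ, σ (m * n) = p + 1 → k ≤ p →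
      (n : ℝ) / ((p : ℝ) + 2) ^ (p + 2) ≤ M n / ((p : ℝ) + 2) := by
    intro n p hp hk
    have h1 := hlow n p hp hk
    have hp0 : (0 : ℝ) ≤ p := Nat.cast_nonneg p
    rw [le_div_iff₀ (by positivity)]
    refine le_trans ?_ h1
    rw [pow_add, ← div_div, div_mul_eq_mul_div, mul_div_assoc]
    refine mul_le_of_le_one_right (by positivity) ?_
    rw [div_le_one (by positivity)]
    nlinarith
  have hlim : Tendsto (fun n => (5 : ℝ) / ((σ (m * n) : ℝ) + 1)) atTop (𝓝 0) := by
    refine Tendsto.div_atTop tendsto_const_nhds (tendsto_atTop_add_const_right _ _ ?_)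
    exact tendsto_natCast_atTop_atTop.comp (hσt.comp (tendsto_id.const_mul_atTop' hm))
  have hMpos : ∀ᶠ n in atTop, 0 < M n := by
    filter_upwards [eventually_gt_atTop 0] with n hn
    exact Finset.sum_pos (fun t _ => hW0 _) (Finset.nonempty_range_iff.2 hn.ne')
  refine ⟨M, hMpos, ?_, fun B => ?_⟩
  · refine squeeze_zero' ?_ ?_ hlim
    · filter_upwards [hMpos] with n hn
      exact div_nonneg (Finset.sum_nonneg fun _ _ => by positivity) hn.le
    · filter_upwards [hMpos, hstage (m + k)] with n hn ⟨p, hp, hmk⟩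
      have h1 := hA p n (hbound n p hp (by omega)).2
      have h2 := hMY n p hp (by omega)
      rw [one_div_mul_eq_div] at h1
      rw [div_le_iff₀ hn, hp]
      push_cast
      have h3 : (0 : ℝ) ≤ M n / ((p : ℝ) + 2) := by positivity
      have h4 : (5 : ℝ) / ((p : ℝ) + 1 + 1) * M n = 5 * (M n / ((p : ℝ) + 2)) := by
        rw [add_assoc]; norm_num; ring
      rw [h4]
      linarith
  rw [tendsto_iff_norm_sub_tendsto_zero]
  refine squeeze_zero' (Eventually.of_forall fun _ => norm_nonneg _) ?_ hlim
  filter_upwards [hMpos, hstage (m + k + d + ∑ j, B j)] with n hn ⟨p, hp, hpC⟩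
  have hBp : ∀ j, B j ≤ p := fun j => by
    have := Finset.single_le_sum (f := B) (fun _ _ => Nat.zero_le _) (Finset.mem_univ j)
    omega
  have hX := (hbound n p hp (by omega)).1
  have hY := hMY n p hp (by omega)
  have hNn : N (p + 1) ≤ m * n := hp ▸ (hσ' (m * n)).1
  have hNn' : m * n < N (p + 2) := by have := (hσ' (m * n)).2; rwa [hp] at this
  set T₁ := (N p + (m - 1 - r)) / m with hT₁
  set T₂ := (N (p + 1) + (m - 1 - r)) / m with hT₂
  have hT₁' : ∀ t, m * t + r < N p ↔ t < T₁ := fun t => mul_add_lt_iff_lt_div hr t _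
  have hT₂' : ∀ t, m * t + r < N (p + 1) ↔ t < T₂ := fun t => mul_add_lt_iff_lt_div hr t _
  have hT₁₂ : T₁ ≤ T₂ := Nat.div_le_div_right (by have := hN (Nat.lt_add_one p); omega)
  have hT₂n : T₂ ≤ n := by
    by_contra! h
    have := (hT₂' n).2 h
    omega
  have hT₁N : T₁ ≤ N p := by
    by_contra! h
    have := (hT₁' _).2 h
    have := Nat.le_mul_of_pos_left (N p) hm
    omega
  have hstep : ∀ s T u : ℕ, m + k + d + ∑ j, B j ≤ s → T ≤ u →
      (∀ t, T ≤ t → N s ≤ m * t + r) → (∀ t < u, m * t + r < N (s + 1)) →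
      |∑ t ∈ Finset.Ico T u, (patternIndicator (fun n => f (σ n) n) d B (m * t + r)
        - W (m * t + r))| ≤ 2 * (D s + u * (1 / ((s : ℝ) + 2) ^ (s + 2))) + d * k := by
    intro s T u hs hTu hT hu
    have hBs : ∀ j, B j ≤ s := fun j => by
      have := Finset.single_le_sum (f := B) (fun _ _ => Nat.zero_le _) (Finset.mem_univ j)
      omega
    refine abs_sum_Ico_le (f := f s) (c := 1 / ((s : ℝ) + 1) ^ k) hr (hε s).le ?_ ?_ ?_
      hTu hT hu
    · intro i h1 h2
      simp only [hσ i s h1 h2]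
    · intro i h1 h2
      simp only [hW, hσ i s h1 h2]
    · intro n
      rw [mul_one_div]
      exact hfD s m r d k (by omega) hr hd (by omega) (by omega) B hBs n
  have hE₂ := hstep p T₁ T₂ hpC hT₁₂ (fun t ht => by
    by_contra! h; have := (hT₁' t).1 h; omega) (fun t ht => (hT₂' t).2 ht)
  have hE₃ := hstep (p + 1) T₂ n (by omega) hT₂n (fun t ht => by
    by_contra! h; have := (hT₂' t).1 h; omega) (fun t ht => by
      have := Nat.mul_le_mul_left m (Nat.succ_le_of_lt ht)
      rw [Nat.succ_eq_add_one, mul_add] at this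
      exact lt_of_lt_of_le (by omega) hNn'.le)
  have hE₁ : |∑ t ∈ Finset.range T₁, (patternIndicator (fun n => f (σ n) n) d B (m * t + r)
        - W (m * t + r))| ≤ N p := by
    refine (Finset.abs_sum_le_sum_abs _ _).trans ?_
    refine (Finset.sum_le_card_nsmul _ _ 1 fun t _ =>
      abs_patternIndicator_sub_le _ d B _ (hW0 _).le (hW1 _)).trans ?_
    rw [Finset.card_range, nsmul_eq_mul, mul_one]
    exact_mod_cast hT₁N
  have hsum : patternCount (fun n => f (σ n) n) m r d B n - M n
      = ∑ t ∈ Finset.range T₁, (patternIndicator (fun n => f (σ n) n) d B (m * t + r)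
          - W (m * t + r))
        + ∑ t ∈ Finset.Ico T₁ T₂, (patternIndicator (fun n => f (σ n) n) d B (m * t + r)
          - W (m * t + r))
        + ∑ t ∈ Finset.Ico T₂ n, (patternIndicator (fun n => f (σ n) n) d B (m * t + r)
          - W (m * t + r)) := by
    rw [Finset.sum_range_add_sum_Ico _ hT₁₂, Finset.sum_range_add_sum_Ico _ hT₂n,
      Finset.sum_sub_distrib]
    rfl
  have hp0 : (0 : ℝ) ≤ p := Nat.cast_nonneg p
  set Y : ℝ := (n : ℝ) / ((p : ℝ) + 2) ^ (p + 2) with hYdef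
  have hXY : (N p : ℝ) + 2 * D (p + 1) + 2 * D p + 2 * (p * p) ≤ Y := by
    rw [hYdef, le_div_iff₀ (by positivity), mul_comm]
    exact hX
  have hY₂ : (T₂ : ℝ) * (1 / ((p : ℝ) + 2) ^ (p + 2)) ≤ Y := by
    rw [mul_one_div, hYdef]
    have : (T₂ : ℝ) ≤ n := by exact_mod_cast hT₂n
    gcongr
  have hY₃ : (n : ℝ) * (1 / (((p + 1 : ℕ) : ℝ) + 2) ^ (p + 1 + 2)) ≤ Y := by
    rw [mul_one_div, hYdef]
    refine div_le_div_of_nonneg_left (Nat.cast_nonneg n) (by positivity) ?_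
    calc ((p : ℝ) + 2) ^ (p + 2) ≤ (((p + 1 : ℕ) : ℝ) + 2) ^ (p + 2) := by
          gcongr; exact p.le_succ
      _ ≤ (((p + 1 : ℕ) : ℝ) + 2) ^ (p + 1 + 2) :=
          pow_le_pow_right₀ (by push_cast; linarith) (by omega)
  have hdk : (d * k : ℝ) ≤ p * p := by
    exact_mod_cast Nat.mul_le_mul (by omega : d ≤ p) (by omega : k ≤ p)
  have hErr : |patternCount (fun n => f (σ n) n) m r d B n - M n| ≤ 5 * Y := by
    rw [hsum]
    refine (abs_add_three _ _ _).trans ?_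
    linarith
  have hfin : patternCount (fun n => f (σ n) n) m r d B n / M n - 1
      = (patternCount (fun n => f (σ n) n) m r d B n - M n) / M n := by
    rw [sub_div, div_self hn.ne']
  rw [hfin, norm_div, Real.norm_eq_abs, Real.norm_eq_abs, abs_of_pos hn, div_le_iff₀ hn, hp]
  refine hErr.trans ?_
  push_cast
  have h4 : (5 : ℝ) / ((p : ℝ) + 1 + 1) * M n = 5 * (M n / ((p : ℝ) + 2)) := by
    rw [add_assoc]; norm_num; ring
  rw [h4]
  linarith

lemma patternCount_eq_card (e : ℕ → ℕ) (m r d : ℕ) {k : ℕ} (B : Fin k → ℕ) (n : ℕ) :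
    patternCount e m r d B n
      = ((Finset.range n).filter fun t => ∀ j : Fin k, e (m * t + r + d * j) = B j).card := by
  unfold patternCount patternIndicator
  rw [← Finset.sum_boole]

lemma apCount_eq_patternCount {q e : ℕ → ℕ} {x : ℝ} (hx : ∀ n, qdigit q x n = e n) {m r : ℕ}
    (hr : r < m) (B : Fin m → ℕ) (n : ℕ) :
    (apCount q x m r B n : ℝ) = patternCount e m r 1 B ((n + (m - 1 - r)) / m) := by
  rw [patternCount_eq_card]
  unfold apCount
  simp only [hx, one_mul]
  norm_cast
  symm
  refine Finset.card_nbij' (fun t => m * t + r) (fun i => i / m) ?_ ?_ ?_ ?_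
  · intro t ht
    simp only [Finset.coe_filter, Finset.mem_range, Set.mem_ofPred_eq] at ht ⊢
    exact ⟨(mul_add_lt_iff_lt_div hr t n).2 ht.1, by
      rw [Nat.mul_add_mod, Nat.mod_eq_of_lt hr], ht.2⟩
  · intro i hi
    simp only [Finset.coe_filter, Finset.mem_range, Set.mem_ofPred_eq] at hi ⊢
    have h : m * (i / m) + r = i := by rw [← hi.2.1]; exact Nat.div_add_mod i m
    rw [h]
    exact ⟨(mul_add_lt_iff_lt_div hr _ n).1 (by rw [h]; exact hi.1), hi.2.2⟩
  · intro t _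
    simp only
    rw [Nat.mul_add_div (by omega), Nat.div_eq_of_lt hr, add_zero]
  · intro i hi
    simp only [Finset.coe_filter, Finset.mem_range, Set.mem_ofPred_eq] at hi ⊢
    rw [← hi.2.1]; exact Nat.div_add_mod i m

lemma blockCount_eq_patternCount {q e : ℕ → ℕ} (hq : IsBasic q) (he : ∀ n, e n + 2 ≤ q n)
    (m r : ℕ) {k : ℕ} (B : Fin k → ℕ) (n : ℕ) :
    (blockCount (lamQ q m r) (Ups q m r (cantorSum q e)) B n : ℝ) = patternCount e m r m B n := by
  rw [patternCount_eq_card, Ups_cantorSum hq he]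
  unfold blockCount
  have h : ∀ t, qdigit (lamQ q m r) (cantorSum (lamQ q m r) fun t => e (m * t + r)) t
      = e (m * t + r) :=
    qdigit_cantorSum (q := lamQ q m r) (fun t => hq _) fun t => he _
  have h' : ∀ i j, m * (i + j) + r = m * i + r + m * j := fun i j => by ring
  simp only [h, h']

lemma prod_inv_le_inv {q : ℕ → ℕ} (hq : IsBasic q) (hmono : Monotone q) {k : ℕ} (hk : 1 ≤ k)
    {j a : ℕ} (hja : j ≤ a) :
    (∏ i ∈ Finset.range k, (q (a + i) : ℝ))⁻¹ ≤ ((q j : ℝ))⁻¹ := by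
  obtain ⟨l, rfl⟩ := Nat.exists_eq_add_of_le' hk
  have hq1 : ∀ i, (1 : ℝ) ≤ q i := fun i => by
    have := hq i; exact_mod_cast (by omega : 1 ≤ q i)
  have h0 : (0 : ℝ) < q j := lt_of_lt_of_le one_pos (hq1 j)
  refine inv_anti₀ h0 ?_
  rw [Finset.prod_range_succ']
  have h1 : (1 : ℝ) ≤ ∏ i ∈ Finset.range l, (q (a + (i + 1)) : ℝ) :=
    Finset.one_le_prod fun i _ => hq1 _
  have h2 : (q j : ℝ) ≤ q (a + 0) := by exact_mod_cast hmono hja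
  nlinarith

lemma apQsum_pos {q : ℕ → ℕ} (hq : IsBasic q) (m r n : ℕ) : 0 < apQsum q m r n :=
  Finset.sum_pos (fun j _ => inv_pos.2 (Finset.prod_pos fun i _ => by
    have := hq (m * j + r + i)
    exact_mod_cast (by omega : 0 < q (m * j + r + i)))) (by simp)

lemma apQsum_le {q : ℕ → ℕ} (hq : IsBasic q) (hmono : Monotone q) {m r : ℕ} (hr : r < m)
    (n : ℕ) : apQsum q m r n
      ≤ ∑ j ∈ Finset.range ((n + (m - 1 - r)) / m + 1), ((q j : ℝ))⁻¹ := by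
  unfold apQsum
  calc _ ≤ ∑ j ∈ Finset.range ((n - r) / m + 1), ((q j : ℝ))⁻¹ :=
        Finset.sum_le_sum fun j _ => prod_inv_le_inv hq hmono (by omega)
          ((Nat.le_mul_of_pos_left j (by omega)).trans (Nat.le_add_right _ _))
    _ ≤ _ := by
        refine Finset.sum_le_sum_of_subset_of_nonneg (fun j hj => ?_)
          fun _ _ _ => by positivity
        rw [Finset.mem_range] at hj ⊢
        have : (n - r) / m ≤ (n + (m - 1 - r)) / m := Nat.div_le_div_right (by omega)
        omega

/-- If counts grow faster than their expected values, their quotient does not tend to `1`. -/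
lemma not_tendsto_div_one {C S T M : ℕ → ℝ} (hM : ∀ᶠ n in atTop, 0 < M n)
    (hC : Tendsto (fun n => C n / M n) atTop (𝓝 1))
    (hT : Tendsto (fun n => T n / M n) atTop (𝓝 0))
    (hS : ∀ᶠ n in atTop, 0 < S n) (hST : ∀ n, S n ≤ T n) :
    ¬ Tendsto (fun n => C n / S n) atTop (𝓝 1) := by
  intro h
  have hSM : Tendsto (fun n => S n / M n) atTop (𝓝 0) := by
    refine squeeze_zero' ?_ ?_ hT
    · filter_upwards [hM, hS] with n h1 h2 using (div_pos h2 h1).le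
    · filter_upwards [hM] with n h1
      exact div_le_div_of_nonneg_right (hST n) h1.le
  have h2 := h.mul hSM
  have h3 : (fun n => C n / S n * (S n / M n)) =ᶠ[atTop] fun n => C n / M n := by
    filter_upwards [hS] with n hn
    rw [div_mul_div_cancel₀ hn.ne']
  have := tendsto_nhds_unique (h2.congr' h3) hC
  norm_num at this

lemma tendsto_div_one {C₁ C₂ M : ℕ → ℝ} (hM : ∀ᶠ n in atTop, 0 < M n)
    (h₁ : Tendsto (fun n => C₁ n / M n) atTop (𝓝 1))
    (h₂ : Tendsto (fun n => C₂ n / M n) atTop (𝓝 1)) :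
    Tendsto (fun n => C₁ n / C₂ n) atTop (𝓝 1) := by
  have h := h₁.div h₂ one_ne_zero
  rw [div_one] at h
  refine h.congr' ?_
  filter_upwards [hM] with n hn
  exact div_div_div_cancel_right₀ hn.ne' _ _

/-- If `Q` is a basic sequence which is non-decreasing and infinite in limit, then
`RN^{I}(Q) ∩ RN^{II}(Q) ∩ N^{I}_{Ab}(Q) \ N^{II}(Q)` is non-empty. -/
theorem stmt5 (Q : ℕ → ℕ) (hQ : IsBasic Q) (hmono : Monotone Q)
    (hinf : InfiniteInLimit Q) :
    (({x : ℝ | MemRNI Q x} ∩ {x : ℝ | MemRNII Q x} ∩ {x : ℝ | APAbnormalI Q x}) \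
      {x : ℝ | APNormalII Q x}).Nonempty := by
  obtain ⟨e, he, hpat⟩ := exists_uniform_digits hQ hinf
  have hx := qdigit_cantorSum hQ he
  have hτ : ∀ m r, r < m → Tendsto (fun n : ℕ => (n + (m - 1 - r)) / m) atTop atTop :=
    fun m r hr => (Nat.tendsto_div_const_atTop (by omega)).comp (tendsto_add_atTop_nat _)
  refine ⟨cantorSum Q e, ⟨⟨?_, ?_⟩, ?_⟩, ?_⟩
  · intro m _ r hr B₁ B₂
    obtain ⟨M, hM, -, hB⟩ := hpat m r 1 m hr one_pos
    simp only [apCount_eq_patternCount hx hr]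
    exact (tendsto_div_one hM (hB B₁) (hB B₂)).comp (hτ m r hr)
  · intro k _ m hm r hr B₁ B₂
    obtain ⟨M, hM, -, hB⟩ := hpat m r m k hr hm
    simp only [blockCount_eq_patternCount hQ he]
    exact tendsto_div_one hM (hB B₁) (hB B₂)
  · intro m _ r hr hmem
    obtain ⟨M, hM, hT, hB⟩ := hpat m r 1 m hr one_pos
    have h := hmem 0
    simp only [apCount_eq_patternCount hx hr] at h
    exact not_tendsto_div_one ((hτ m r hr).eventually hM) ((hB 0).comp (hτ m r hr))
      (hT.comp (hτ m r hr)) (Eventually.of_forall (apQsum_pos hQ m r)) (apQsum_le hQ hmono hr) h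
  · intro hmem
    obtain ⟨M, hM, hT, hB⟩ := hpat 1 0 1 1 one_pos one_pos
    have h := hmem 1 le_rfl 1 le_rfl 0 one_pos 0
    simp only [blockCount_eq_patternCount hQ he] at h
    have hpos : ∀ j, (0 : ℝ) < ∏ i ∈ Finset.range 1, (lamQ Q 1 0 (j + i) : ℝ) := fun j =>
      Finset.prod_pos fun i _ => by
        have := hQ (1 * (j + i) + 0)
        exact_mod_cast (by unfold lamQ; omega : 0 < lamQ Q 1 0 (j + i))
    refine not_tendsto_div_one hM (hB 0) hT ?_ (fun n => ?_) h
    · filter_upwards [eventually_gt_atTop 0] with n hn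
      exact Finset.sum_pos (fun j _ => inv_pos.2 (hpos j)) (Finset.nonempty_range_iff.2 hn.ne')
    · unfold Qsum
      rw [Finset.sum_range_succ]
      refine le_add_of_le_of_nonneg (Finset.sum_le_sum fun j _ => ?_) (by positivity)
      simp [lamQ]
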